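/- arXiv:1805.08076 — 2 statements merged into one kernel-verified Lean document; each statement's English description precedes it below -/
import Mathlib

section
/- Let T_n denote the coefficient of z^n in the polynomial (1 + z + z²)^n (the n-th central trinomial coefficient). Then T_0 = 1, T_1 = 1, and for every n ≥ 2 the recurrence n·T_n = (2n−1)·T_{n−1} + 3(n−1)·T_{n−2} holds. -/
open Polynomial in
lemma tri_coeff (R : ℤ[X]) (k : ℕ) :
    ((1 + X + X ^ 2) * R).coeff (k + 2) = R.coeff (k + 2) + R.coeff (k + 1) + R.coeff k := by
  have h1 : (X * R).coeff (k + 1 + 1) = R.coeff (k + 1) := coeff_X_mul R (k + 1)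
  have h2 : (X ^ 2 * R).coeff (k + 2) = R.coeff k := coeff_X_pow_mul R 2 k
  rw [add_mul, add_mul, one_mul, coeff_add, coeff_add, h2]
  rw [show k + 2 = k + 1 + 1 from rfl, h1]

open Polynomial in
lemma tri_coeff_one (R : ℤ[X]) :
    ((1 + X + X ^ 2) * R).coeff 1 = R.coeff 1 + R.coeff 0 := by
  have h1 : (X * R).coeff (0 + 1) = R.coeff 0 := coeff_X_mul R 0
  have h2 : (X ^ 2 * R).coeff 1 = 0 := by
    rw [coeff_X_pow_mul']; simp
  rw [add_mul, add_mul, one_mul, coeff_add, coeff_add, h2]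
  simp

open Polynomial in
lemma tri_coeff_zero (R : ℤ[X]) :
    ((1 + X + X ^ 2) * R).coeff 0 = R.coeff 0 := by
  simp [mul_coeff_zero]

open Polynomial in
lemma tri_deriv (m k : ℕ) :
    ((k : ℤ) + 2) * ((1 + X + X ^ 2 : ℤ[X]) ^ m).coeff (k + 2)
      + ((k : ℤ) + 1) * ((1 + X + X ^ 2 : ℤ[X]) ^ m).coeff (k + 1)
      + (k : ℤ) * ((1 + X + X ^ 2 : ℤ[X]) ^ m).coeff k
    = (m : ℤ) * (((1 + X + X ^ 2 : ℤ[X]) ^ m).coeff (k + 1)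
      + 2 * ((1 + X + X ^ 2 : ℤ[X]) ^ m).coeff k) := by
  set Q := (1 + X + X ^ 2 : ℤ[X]) ^ m with hQ
  have hX : ∀ i : ℕ, (X * derivative Q).coeff i = (i : ℤ) * Q.coeff i := by
    intro i
    cases i with
    | zero => simp
    | succ i => rw [coeff_X_mul, coeff_derivative]; push_cast; ring
  have key : (1 + X + X ^ 2) * (X * derivative Q)
      = C (m : ℤ) * (X * Q) + C (2 * m : ℤ) * (X ^ 2 * Q) := by
    cases m with
    | zero => simp [hQ]
    | succ m =>
      rw [hQ, derivative_pow_succ]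
      simp
      ring
  have h := congrArg (fun p => p.coeff (k + 2)) key
  simp only [tri_coeff, hX, coeff_add, coeff_C_mul] at h
  have h1 : (X * Q).coeff (k + 2) = Q.coeff (k + 1) := coeff_X_mul Q (k + 1)
  rw [h1, coeff_X_pow_mul] at h
  push_cast at h
  linarith

/-- Let `T_n` be the coefficient of `z^n` in `(1 + z + z²)^n` (the `n`-th central
trinomial coefficient).  Then `T₀ = 1`, `T₁ = 1`, and for every `n ≥ 2` the recurrence
`n·T_n = (2n−1)·T_{n−1} + 3(n−1)·T_{n−2}` holds. -/
theorem central_trinomial_recurrence (T : ℕ → ℤ)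
    (hT : ∀ n : ℕ, T n = ((1 + Polynomial.X + Polynomial.X ^ 2 : Polynomial ℤ) ^ n).coeff n) :
    T 0 = 1 ∧ T 1 = 1 ∧
      ∀ n : ℕ, 2 ≤ n →
        (n : ℤ) * T n = (2 * (n : ℤ) - 1) * T (n - 1) + 3 * ((n : ℤ) - 1) * T (n - 2) := by
  refine ⟨by simp [hT], by simp [hT, Polynomial.coeff_one, Polynomial.coeff_X], ?_⟩
  intro n hn
  obtain ⟨m, rfl⟩ := Nat.exists_eq_add_of_le' hn
  simp only [hT, show m + 2 - 1 = m + 1 from rfl, Nat.add_sub_cancel]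
  have t2 : ∀ i k : ℕ, ((1 + Polynomial.X + Polynomial.X ^ 2 : Polynomial ℤ) ^ (i + 1)).coeff (k + 2)
      = ((1 + Polynomial.X + Polynomial.X ^ 2 : Polynomial ℤ) ^ i).coeff (k + 2)
      + ((1 + Polynomial.X + Polynomial.X ^ 2 : Polynomial ℤ) ^ i).coeff (k + 1)
      + ((1 + Polynomial.X + Polynomial.X ^ 2 : Polynomial ℤ) ^ i).coeff k := by
    intro i k
    rw [pow_succ', tri_coeff]
  have t1 : ∀ i : ℕ, ((1 + Polynomial.X + Polynomial.X ^ 2 : Polynomial ℤ) ^ (i + 1)).coeff 1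
      = ((1 + Polynomial.X + Polynomial.X ^ 2 : Polynomial ℤ) ^ i).coeff 1
      + ((1 + Polynomial.X + Polynomial.X ^ 2 : Polynomial ℤ) ^ i).coeff 0 := by
    intro i
    rw [pow_succ', tri_coeff_one]
  have t0 : ∀ i : ℕ, ((1 + Polynomial.X + Polynomial.X ^ 2 : Polynomial ℤ) ^ (i + 1)).coeff 0
      = ((1 + Polynomial.X + Polynomial.X ^ 2 : Polynomial ℤ) ^ i).coeff 0 := by
    intro i
    rw [pow_succ', tri_coeff_zero]
  have d := tri_deriv
  generalize (1 + Polynomial.X + Polynomial.X ^ 2 : Polynomial ℤ) = P at t2 t1 t0 d ⊢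
  have z0 : (P ^ 0).coeff 0 = 1 := by simp
  have z1 : ∀ i, (P ^ 0).coeff (i + 1) = 0 := by simp [Polynomial.coeff_one]
  rcases m with _ | _ | j
  · have := z1 0
    have := z1 1
    have := t2 1 0
    have := t2 0 0
    have := t1 0
    have := t0 0
    norm_num only [Nat.cast_zero, Nat.cast_add, Nat.cast_ofNat] at *
    linarith
  · have := z1 0
    have := z1 1
    have := z1 2
    have := t2 2 1
    have := t2 1 1
    have := t2 1 0
    have := t2 0 1
    have := t2 0 0
    have := t1 1
    have := t1 0
    have := t0 0
    norm_num only [Nat.cast_zero, Nat.cast_one, Nat.cast_add, Nat.cast_ofNat] at *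
    linarith
  · have e1 := d (j + 2) j
    have e2 := d (j + 2) (j + 2)
    have f0 := t2 (j + 3) (j + 2)
    have f1 := t2 (j + 2) (j + 2)
    have f2 := t2 (j + 2) (j + 1)
    have f3 := t2 (j + 2) j
    simp only [add_assoc, Nat.reduceAdd] at e1 e2 f0 f1 f2 f3 ⊢
    push_cast at e1 e2 ⊢
    rw [f0, f1, f2, f3]
    linarith
end

section
/- For n ≥ 2, let b_n denote the coefficient of z^{n−2} in the polynomial (1 + z + z²)^{n−1}. Then b_2 = 1, b_3 = 2, and for every n ≥ 4 the recurrence n(n−2)·b_n = (n−1)(2n−3)·b_{n−1} + 3(n−1)(n−2)·b_{n−2} holds. -/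
open Polynomial in
lemma tri_step (m k : ℕ) :
    ((1 + X + X ^ 2 : ℤ[X]) ^ (m + 1)).coeff (k + 2) =
      ((1 + X + X ^ 2 : ℤ[X]) ^ m).coeff (k + 2) + ((1 + X + X ^ 2 : ℤ[X]) ^ m).coeff (k + 1)
        + ((1 + X + X ^ 2 : ℤ[X]) ^ m).coeff k := by
  rw [pow_succ, mul_add, mul_add, mul_one, coeff_add, coeff_add, coeff_mul_X, coeff_mul_X_pow]

/-- For `n ≥ 2`, let `b_n` be the coefficient of `z^{n−2}` in `(1 + z + z²)^{n−1}`.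
Then `b₂ = 1`, `b₃ = 2`, and for every `n ≥ 4` the recurrence
`n(n−2)·b_n = (n−1)(2n−3)·b_{n−1} + 3(n−1)(n−2)·b_{n−2}` holds. -/
theorem one_child_count_recurrence (b : ℕ → ℤ)
    (hb : ∀ n : ℕ, 2 ≤ n →
      b n = ((1 + Polynomial.X + Polynomial.X ^ 2 : Polynomial ℤ) ^ (n - 1)).coeff (n - 2)) :
    b 2 = 1 ∧ b 3 = 2 ∧
      ∀ n : ℕ, 4 ≤ n →
        (n : ℤ) * ((n : ℤ) - 2) * b n =
          ((n : ℤ) - 1) * (2 * (n : ℤ) - 3) * b (n - 1) +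
            3 * ((n : ℤ) - 1) * ((n : ℤ) - 2) * b (n - 2) := by
  have h2 : b 2 = 1 := by rw [hb 2 le_rfl]; simp
  have h3 : b 3 = 2 := by
    rw [hb 3 (by norm_num)]
    have := tri_deriv 2 0
    simp [Polynomial.coeff_zero_eq_eval_zero] at this
    have e : ((1 + Polynomial.X + Polynomial.X ^ 2 : Polynomial ℤ) ^ 2) =
      1 + Polynomial.C 2 * Polynomial.X ^ 1 + Polynomial.C 3 * Polynomial.X ^ 2
        + Polynomial.C 2 * Polynomial.X ^ 3 + Polynomial.X ^ 4 := by
      simp only [map_ofNat]; ring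
    show ((1 + Polynomial.X + Polynomial.X ^ 2 : Polynomial ℤ) ^ 2).coeff 1 = 2
    rw [e]
    simp only [Polynomial.coeff_add, Polynomial.coeff_C_mul, Polynomial.coeff_X_pow,
      Polynomial.coeff_one]
    norm_num
  refine ⟨h2, h3, ?_⟩
  intro n hn
  obtain ⟨i, rfl⟩ := Nat.exists_eq_add_of_le' hn
  cases i with
  | zero =>
    have h4 : b 4 = 6 := by
      rw [hb 4 (by norm_num)]
      have e : ((1 + Polynomial.X + Polynomial.X ^ 2 : Polynomial ℤ) ^ 3) =
        1 + Polynomial.C 3 * Polynomial.X ^ 1 + Polynomial.C 6 * Polynomial.X ^ 2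
          + Polynomial.C 7 * Polynomial.X ^ 3 + Polynomial.C 6 * Polynomial.X ^ 4
          + Polynomial.C 3 * Polynomial.X ^ 5 + Polynomial.X ^ 6 := by
        simp only [map_ofNat]; ring
      show ((1 + Polynomial.X + Polynomial.X ^ 2 : Polynomial ℤ) ^ 3).coeff 2 = 6
      rw [e]
      simp only [Polynomial.coeff_add, Polynomial.coeff_C_mul, Polynomial.coeff_X_pow,
        Polynomial.coeff_one]
      norm_num
    norm_num [h2, h3, h4]
  | succ i =>
    -- with m = i + 2, the three values are u_{m+2}, u_{m+1}, u_m
    have e2 := hb (i + 1 + 4) (by omega)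
    have e1 := hb (i + 1 + 4 - 1) (by omega)
    have e0 := hb (i + 1 + 4 - 2) (by omega)
    rw [e2, e1, e0]
    simp only [show i + 1 + 4 - 1 = i + 4 by omega, show i + 1 + 4 - 2 = i + 3 by omega,
      show i + 4 - 1 = i + 3 by omega, show i + 4 - 2 = i + 2 by omega,
      show i + 3 - 1 = i + 2 by omega, show i + 3 - 2 = i + 1 by omega]
    have s1 := tri_step (i + 3) (i + 1)
    have s2 := tri_step (i + 2) i
    have s3 := tri_step (i + 2) (i + 1)
    have d1 := tri_deriv (i + 2) i
    have d2 := tri_deriv (i + 2) (i + 1)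
    have d3 := tri_deriv (i + 3) (i + 1)
    simp only [Nat.add_assoc, Nat.reduceAdd] at s1 s2 s3 d1 d2 d3 ⊢
    push_cast at d1 d2 d3 ⊢
    generalize ((1 + Polynomial.X + Polynomial.X ^ 2 : Polynomial ℤ) ^ (i + 4)).coeff (i + 3) = u2 at *
    generalize ((1 + Polynomial.X + Polynomial.X ^ 2 : Polynomial ℤ) ^ (i + 3)).coeff (i + 3) = c1 at *
    generalize ((1 + Polynomial.X + Polynomial.X ^ 2 : Polynomial ℤ) ^ (i + 3)).coeff (i + 2) = u1 at *
    generalize ((1 + Polynomial.X + Polynomial.X ^ 2 : Polynomial ℤ) ^ (i + 3)).coeff (i + 1) = w1 at *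
    generalize ((1 + Polynomial.X + Polynomial.X ^ 2 : Polynomial ℤ) ^ (i + 2)).coeff (i + 3) = v at *
    generalize ((1 + Polynomial.X + Polynomial.X ^ 2 : Polynomial ℤ) ^ (i + 2)).coeff (i + 2) = c at *
    generalize ((1 + Polynomial.X + Polynomial.X ^ 2 : Polynomial ℤ) ^ (i + 2)).coeff (i + 1) = u at *
    generalize ((1 + Polynomial.X + Polynomial.X ^ 2 : Polynomial ℤ) ^ (i + 2)).coeff i = w at *
    have hv : v = u := by
      have h0 : ((i : ℤ) + 3) ≠ 0 := by positivity
      apply mul_left_cancel₀ h0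
      linarith
    subst hv
    have f1 : ((i : ℤ) + 4) * u1 = (2 * i + 6) * c + (i + 3) * v := by
      rw [s2]; linarith
    have f2 : ((i : ℤ) + 5) * u2 = (2 * i + 8) * c1 + (i + 4) * u1 := by
      rw [s1]; linarith
    have f3 : c1 = c + 2 * v := by linarith
    subst f3
    linear_combination ((i : ℤ) + 3) * f2 - ((i : ℤ) + 4) * f1
end
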